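/- Let x = (x_1, …, x_n) be a real unit vector with x_1 ≥ x_2 ≥ … ≥ x_n ≥ 0, let k be the maximum element of { ℓ ∈ {1, …, n} : x_ℓ > q_ℓ }, and let D = diag(d_1, …, d_k, 0, …, 0) with d_j = (x_j − q_k)/(s_k − k·q_k) for 1 ≤ j ≤ k. Then D attains the minimum over all incoherent states δ of ‖|x⟩⟨x| − δ‖_tr and also the minimum over all incoherent states δ of ‖|x⟩⟨x| − δ‖; moreover, min_{δ incoherent} ‖|x⟩⟨x| − δ‖_tr = ‖|x⟩⟨x| − D‖_tr = 2·(q_k·s_k + m_k) and min_{δ incoherent} ‖|x⟩⟨x| − δ‖ = ‖|x⟩⟨x| − D‖ = q_k·s_k + m_k. -/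

import Mathlib

open Matrix BigOperators
open scoped ComplexOrder

/-- The trace norm of a Hermitian matrix: the sum of the absolute values of its
eigenvalues (junk value `0` for non-Hermitian matrices). -/
noncomputable def traceNorm {m : Type*} [Fintype m] [DecidableEq m] (A : Matrix m m ℂ) : ℝ :=
  if h : A.IsHermitian then ∑ i, |h.eigenvalues i| else 0

/-- The operator norm of a Hermitian matrix: the maximum of the absolute values of its
eigenvalues (junk value `0` for non-Hermitian matrices). -/
noncomputable def opNorm {m : Type*} [Fintype m] [DecidableEq m] (A : Matrix m m ℂ) : ℝ :=
  if h : A.IsHermitian then ⨆ i, |h.eigenvalues i| else 0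

/-- A density matrix: positive semidefinite with trace 1. -/
def IsDensity {m : Type*} [Fintype m] (A : Matrix m m ℂ) : Prop :=
  A.PosSemidef ∧ A.trace = 1

/-- An incoherent state: a diagonal density matrix. -/
def IsIncoherent {m : Type*} [Fintype m] [DecidableEq m] (A : Matrix m m ℂ) : Prop :=
  IsDensity A ∧ ∀ i j, i ≠ j → A i j = 0

/-- `|x⟩⟨x|`, the rank-one matrix with `(i,j)` entry `x i * conj (x j)`. -/
def outer {m : Type*} (x : m → ℂ) : Matrix m m ℂ :=
  Matrix.of fun i j => x i * star (x j)

/-- `ent x ℓ` is the 1-based entry `x_ℓ` of `x` (junk value `0` outside `{1,…,n}`). -/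
noncomputable def ent {n : ℕ} (x : Fin n → ℝ) (ℓ : ℕ) : ℝ :=
  if h : 1 ≤ ℓ ∧ ℓ ≤ n then x ⟨ℓ - 1, by omega⟩ else 0

/-- `s_ℓ = ∑_{j=1}^{ℓ} x_j`. -/
noncomputable def sVal {n : ℕ} (x : Fin n → ℝ) (ℓ : ℕ) : ℝ :=
  ∑ j ∈ Finset.Icc 1 ℓ, ent x j

/-- `m_ℓ = ∑_{j=ℓ+1}^{n} x_j²`. -/
noncomputable def mVal {n : ℕ} (x : Fin n → ℝ) (ℓ : ℕ) : ℝ :=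
  ∑ j ∈ Finset.Icc (ℓ + 1) n, (ent x j) ^ 2

/-- `p_ℓ = s_ℓ² − 1 − ℓ·m_ℓ`. -/
noncomputable def pVal {n : ℕ} (x : Fin n → ℝ) (ℓ : ℕ) : ℝ :=
  (sVal x ℓ) ^ 2 - 1 - ℓ * mVal x ℓ

/-- `q_ℓ = (p_ℓ + √(p_ℓ² + 4·ℓ·m_ℓ·s_ℓ²)) / (2·ℓ·s_ℓ)`. -/
noncomputable def qVal {n : ℕ} (x : Fin n → ℝ) (ℓ : ℕ) : ℝ :=
  (pVal x ℓ + Real.sqrt ((pVal x ℓ) ^ 2 + 4 * ℓ * mVal x ℓ * (sVal x ℓ) ^ 2)) /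
    (2 * ℓ * sVal x ℓ)

/-- The incoherent candidate `D = diag(d_1, …, d_k, 0, …, 0)` with
`d_j = (x_j − q_k)/(s_k − k·q_k)`, as a complex matrix. -/
noncomputable def DmatC {n : ℕ} (x : Fin n → ℝ) (k : ℕ) : Matrix (Fin n) (Fin n) ℂ :=
  Matrix.diagonal fun i =>
    if (i : ℕ) + 1 ≤ k then
      (((ent x ((i : ℕ) + 1) - qVal x k) / (sVal x k - k * qVal x k) : ℝ) : ℂ)
    else 0

/-- `|x⟩⟨x|` for a real vector `x`, as a complex matrix. -/
noncomputable def outerR {n : ℕ} (x : Fin n → ℝ) : Matrix (Fin n) (Fin n) ℂ :=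
  outer fun i => (x i : ℂ)

/-- The eigenbasis of a Hermitian matrix diagonalises its quadratic form isometrically. -/
theorem Matrix.IsHermitian.exists_diagonalization {m : Type*} [Fintype m] [DecidableEq m]
    {A : Matrix m m ℂ} (hA : A.IsHermitian) :
    ∃ U : Matrix m m ℂ, (∀ y, ∃ z, y = U *ᵥ z) ∧
      (∀ z, star (U *ᵥ z) ⬝ᵥ (A *ᵥ (U *ᵥ z)) = ((∑ i, hA.eigenvalues i * ‖z i‖ ^ 2 : ℝ) : ℂ)) ∧
      ∀ z, ∑ i, ‖(U *ᵥ z) i‖ ^ 2 = ∑ i, ‖z i‖ ^ 2 := by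
  have hsq : ∀ z : m → ℂ, ((∑ i, ‖z i‖ ^ 2 : ℝ) : ℂ) = star z ⬝ᵥ z := by
    intro z
    simp [dotProduct, ← Complex.conj_mul']
  set V : Matrix m m ℂ := (hA.eigenvectorUnitary : Matrix m m ℂ) with hV
  have h1 : star V * V = 1 := Unitary.coe_star_mul_self _
  have h2 : V * star V = 1 := Unitary.coe_mul_star_self _
  have hstar : ∀ z w : m → ℂ, star (V *ᵥ z) ⬝ᵥ w = star z ⬝ᵥ (star V *ᵥ w) := by
    intro z w
    rw [star_mulVec, ← dotProduct_mulVec, star_eq_conjTranspose]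
  refine ⟨V, fun y => ⟨star V *ᵥ y, by simp [mulVec_mulVec, h2]⟩, fun z => ?_, fun z => ?_⟩
  · have hspec : star V * A * V = diagonal (fun i => (hA.eigenvalues i : ℂ)) := by
      have := hA.conjStarAlgAut_star_eigenvectorUnitary
      rw [Unitary.conjStarAlgAut_star_apply] at this
      exact this
    rw [hstar, mulVec_mulVec, mulVec_mulVec, hspec]
    simp only [dotProduct, mulVec_diagonal, Pi.star_apply]
    push_cast
    refine Finset.sum_congr rfl fun i _ => ?_
    rw [← Complex.conj_mul']
    simp
    ring
  · have : ((∑ i, ‖(V *ᵥ z) i‖ ^ 2 : ℝ) : ℂ) = ((∑ i, ‖z i‖ ^ 2 : ℝ) : ℂ) := by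
      rw [hsq, hsq, hstar, mulVec_mulVec, h1, one_mulVec]
    exact_mod_cast this

/-- If a family of reals sums to zero and has at most one positive member, then that member
(or, if there is none, zero) controls both the `ℓ¹` and the `ℓ^∞` norm of the family. -/
theorem exists_sum_abs_eq_two_mul {ι : Type*} [Fintype ι] [Nonempty ι]
    (f : ι → ℝ) (hsum : ∑ i, f i = 0) (hpos : ∀ i j, i ≠ j → 0 < f i → f j ≤ 0) :
    ∃ i₀, (∀ i, f i ≤ f i₀) ∧ ∑ i, |f i| = 2 * f i₀ ∧ ⨆ i, |f i| = f i₀ ∧ 0 ≤ f i₀ := by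
  classical
  obtain ⟨i₀, hmax⟩ := Finite.exists_max f
  have hneg : ∀ j, j ≠ i₀ → f j ≤ 0 := by
    intro j hj
    by_contra! h
    exact absurd (hpos j i₀ hj h) (not_le.mpr (h.trans_le (hmax j)))
  have hsplit := Finset.add_sum_erase Finset.univ f (Finset.mem_univ i₀)
  rw [hsum] at hsplit
  have hle : ∑ i ∈ Finset.univ.erase i₀, f i ≤ 0 :=
    Finset.sum_nonpos fun i hi => hneg i (Finset.ne_of_mem_erase hi)
  have h0 : 0 ≤ f i₀ := by linarith
  have habs : ∑ i ∈ Finset.univ.erase i₀, |f i| = -∑ i ∈ Finset.univ.erase i₀, f i := by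
    rw [← Finset.sum_neg_distrib]
    exact Finset.sum_congr rfl fun i hi => abs_of_nonpos (hneg i (Finset.ne_of_mem_erase hi))
  refine ⟨i₀, hmax, ?_, ?_, h0⟩
  · rw [← Finset.add_sum_erase Finset.univ _ (Finset.mem_univ i₀), habs, abs_of_nonneg h0]
    linarith
  · refine le_antisymm (ciSup_le fun i => ?_) ?_
    · by_cases hi : i = i₀
      · rw [hi, abs_of_nonneg h0]
      · have := Finset.single_le_sum (f := fun i => |f i|) (fun i _ => abs_nonneg _)
          (Finset.mem_erase.mpr ⟨hi, Finset.mem_univ i⟩)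
        simp only [habs] at this
        linarith
    · exact (le_abs_self _).trans
        (le_ciSup (f := fun i => |f i|) (Set.finite_range _).bddAbove i₀)

theorem isHermitian_outerR_sub_diagonal {n : ℕ} (x d : Fin n → ℝ) :
    (outerR x - diagonal fun i => (d i : ℂ)).IsHermitian := by
  refine IsHermitian.sub ?_ ?_
  · ext i j
    simp [outerR, outer, mul_comm]
  · rw [IsHermitian, diagonal_conjTranspose]
    congr 1
    ext i
    simp

theorem star_dotProduct_outerR_sub_diagonal_mulVec {n : ℕ} (x d : Fin n → ℝ) (y : Fin n → ℂ) :
    star y ⬝ᵥ ((outerR x - diagonal fun i => (d i : ℂ)) *ᵥ y) =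
      ((‖∑ i, (x i : ℂ) * y i‖ ^ 2 - ∑ i, d i * ‖y i‖ ^ 2 : ℝ) : ℂ) := by
  have hx : star y ⬝ᵥ (outerR x *ᵥ y) = star (∑ i, (x i : ℂ) * y i) * ∑ i, (x i : ℂ) * y i := by
    rw [star_sum, Finset.sum_mul]
    refine Finset.sum_congr rfl fun i _ => ?_
    simp only [outerR, outer, mulVec, dotProduct, of_apply, Pi.star_apply, Finset.mul_sum, star_mul]
    refine Finset.sum_congr rfl fun j _ => ?_
    simp
    ring
  rw [sub_mulVec, dotProduct_sub, hx]
  push_cast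
  congr 1
  · exact Complex.conj_mul' _
  · refine Finset.sum_congr rfl fun i _ => ?_
    rw [mulVec_diagonal, ← Complex.conj_mul']
    simp
    ring

/-- For a unit vector `x` and an incoherent state `diag d`, the trace norm of `|x⟩⟨x| - diag d` is
twice its operator norm, and the operator norm is the largest value of the quadratic form. -/
theorem norms_outerR_sub_diagonal {n : ℕ} (hn : 1 ≤ n) (x d : Fin n → ℝ)
    (hx : ∑ i, x i ^ 2 = 1) (hd : ∀ i, 0 ≤ d i) (hd1 : ∑ i, d i = 1) :
    ∃ μ : ℝ, traceNorm (outerR x - diagonal fun i => (d i : ℂ)) = 2 * μ ∧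
      opNorm (outerR x - diagonal fun i => (d i : ℂ)) = μ ∧ 0 ≤ μ ∧
      (∀ y : Fin n → ℂ, ‖∑ i, (x i : ℂ) * y i‖ ^ 2 - ∑ i, d i * ‖y i‖ ^ 2 ≤
        μ * ∑ i, ‖y i‖ ^ 2) ∧
      ∃ y : Fin n → ℂ, ∑ i, ‖y i‖ ^ 2 = 1 ∧
        ‖∑ i, (x i : ℂ) * y i‖ ^ 2 - ∑ i, d i * ‖y i‖ ^ 2 = μ := by
  have hA := isHermitian_outerR_sub_diagonal x d
  have : Nonempty (Fin n) := ⟨⟨0, hn⟩⟩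
  rw [traceNorm, opNorm, dif_pos hA, dif_pos hA]
  obtain ⟨U, hU, hQ, hN⟩ := hA.exists_diagonalization
  set f := hA.eigenvalues with hf
  have hQ' : ∀ z, ‖∑ i, (x i : ℂ) * (U *ᵥ z) i‖ ^ 2 - ∑ i, d i * ‖(U *ᵥ z) i‖ ^ 2 =
      ∑ i, f i * ‖z i‖ ^ 2 := by
    intro z
    have := hQ z
    rw [star_dotProduct_outerR_sub_diagonal_mulVec] at this
    exact_mod_cast this
  have hker : ∀ z, ∑ i, (x i : ℂ) * (U *ᵥ z) i = 0 → ∑ i, f i * ‖z i‖ ^ 2 ≤ 0 := by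
    intro z hz
    rw [← hQ', hz]
    have : 0 ≤ ∑ i, d i * ‖(U *ᵥ z) i‖ ^ 2 :=
      Finset.sum_nonneg fun i _ => mul_nonneg (hd i) (sq_nonneg _)
    simpa using this
  have hsum : ∑ i, f i = 0 := by
    have h1 := hA.trace_eq_sum_eigenvalues
    have h2 : (outerR x - diagonal fun i => (d i : ℂ)).trace =
        ((∑ i, x i ^ 2 - ∑ i, d i : ℝ) : ℂ) := by
      simp [Matrix.trace, outerR, outer, sq]
    rw [h2, hx, hd1] at h1
    have h3 : ((∑ i, f i : ℝ) : ℂ) = 0 := by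
      push_cast
      rw [hf]
      simpa using h1.symm
    exact_mod_cast h3
  have hsingle : ∀ i : Fin n, ∑ k, f k * ‖(Pi.single i 1 : Fin n → ℂ) k‖ ^ 2 = f i := by
    intro i
    rw [Finset.sum_eq_single i] <;> simp +contextual
  have hpos : ∀ i j, i ≠ j → 0 < f i → f j ≤ 0 := by
    intro i j hij hi
    by_contra! hj
    set φ : (Fin n → ℂ) → ℂ := fun z => ∑ k, (x k : ℂ) * (U *ᵥ z) k with hφ
    have hφi : φ (Pi.single i 1) ≠ 0 := by
      intro h
      have := hker _ h
      rw [hsingle] at this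
      linarith
    set z : Fin n → ℂ := φ (Pi.single j 1) • Pi.single i 1 - φ (Pi.single i 1) • Pi.single j 1
      with hz
    have hφz : φ z = 0 := by
      have hlin : φ z = φ (Pi.single j 1) * φ (Pi.single i 1) -
          φ (Pi.single i 1) * φ (Pi.single j 1) := by
        simp only [hφ, hz, mulVec_sub, mulVec_smul, Pi.sub_apply, Pi.smul_apply, smul_eq_mul,
          mul_sub, Finset.sum_sub_distrib]
        congr 1 <;>
        · conv_rhs => rw [Finset.mul_sum]
          exact Finset.sum_congr rfl fun k _ => by ring
      rw [hlin]
      ring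
    have hle := hker z hφz
    have hzj : z j = -φ (Pi.single i 1) := by simp [hz, hij.symm]
    have hval : ∑ k, f k * ‖z k‖ ^ 2 = f i * ‖z i‖ ^ 2 + f j * ‖z j‖ ^ 2 := by
      rw [← Finset.sum_pair (f := fun k => f k * ‖z k‖ ^ 2) hij]
      symm
      refine Finset.sum_subset (Finset.subset_univ _) fun k _ hk => ?_
      simp only [Finset.mem_insert, Finset.mem_singleton, not_or] at hk
      simp [hz, hk.1, hk.2]
    rw [hval, hzj, norm_neg] at hle
    have : 0 < f j * ‖φ (Pi.single i 1)‖ ^ 2 :=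
      mul_pos hj (pow_pos (norm_pos_iff.mpr hφi) 2)
    have : 0 ≤ f i * ‖z i‖ ^ 2 := mul_nonneg hi.le (sq_nonneg _)
    linarith
  obtain ⟨i₀, hmax, htr, hop, h0⟩ := exists_sum_abs_eq_two_mul f hsum hpos
  refine ⟨f i₀, htr, hop, h0, fun y => ?_, U *ᵥ Pi.single i₀ 1, ?_, ?_⟩
  · obtain ⟨z, rfl⟩ := hU y
    rw [hQ', hN, Finset.mul_sum]
    exact Finset.sum_le_sum fun i _ => mul_le_mul_of_nonneg_right (hmax i) (sq_nonneg _)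
  · rw [hN, Finset.sum_eq_single i₀] <;> simp +contextual
  · rw [hQ', hsingle]

theorem IsIncoherent.exists_eq_diagonal {n : ℕ} {δ : Matrix (Fin n) (Fin n) ℂ}
    (h : IsIncoherent δ) :
    ∃ d : Fin n → ℝ, δ = diagonal (fun i => (d i : ℂ)) ∧ (∀ i, 0 ≤ d i) ∧ ∑ i, d i = 1 := by
  obtain ⟨⟨hpsd, htr⟩, hoff⟩ := h
  have hre : ∀ i, 0 ≤ (δ i i).re ∧ δ i i = ((δ i i).re : ℂ) := by
    intro i
    have := Complex.le_def.mp (hpsd.diag_nonneg (i := i))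
    exact ⟨this.1, Complex.ext rfl (by simpa using this.2.symm)⟩
  refine ⟨fun i => (δ i i).re, ?_, fun i => (hre i).1, ?_⟩
  · ext i j
    by_cases hij : i = j
    · subst hij
      simpa using (hre i).2
    · simp [hij, hoff i j hij]
  · have := congrArg Complex.re htr
    simpa [Matrix.trace] using this

theorem isIncoherent_diagonal {n : ℕ} {d : Fin n → ℝ} (hd : ∀ i, 0 ≤ d i) (hd1 : ∑ i, d i = 1) :
    IsIncoherent (diagonal fun i => (d i : ℂ)) := by
  refine ⟨⟨PosSemidef.diagonal fun i => ?_, ?_⟩, fun i j hij => diagonal_apply_ne _ hij⟩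
  · simpa using hd i
  · rw [trace_diagonal]
    exact_mod_cast hd1

theorem sum_fin_ite_succ_le {n k : ℕ} (hk : k ≤ n) (h : ℕ → ℝ) :
    ∑ i : Fin n, (if (i : ℕ) + 1 ≤ k then h (i + 1) else 0) = ∑ j ∈ Finset.Icc 1 k, h j := by
  rw [Fin.sum_univ_eq_sum_range (fun i => if i + 1 ≤ k then h (i + 1) else 0) n,
    ← Finset.sum_filter]
  refine Finset.sum_bij' (fun i _ => i + 1) (fun j _ => j - 1) ?_ ?_ ?_ ?_ ?_ <;>
    simp <;> omega

theorem sum_fin_ite_le_succ {n k : ℕ} (h : ℕ → ℝ) :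
    ∑ i : Fin n, (if (i : ℕ) + 1 ≤ k then 0 else h (i + 1)) =
      ∑ j ∈ Finset.Icc (k + 1) n, h j := by
  rw [Fin.sum_univ_eq_sum_range (fun i => if i + 1 ≤ k then 0 else h (i + 1)) n]
  simp_rw [← ite_not (p := _ ≤ k)]
  rw [← Finset.sum_filter]
  refine Finset.sum_bij' (fun i _ => i + 1) (fun j _ => j - 1) ?_ ?_ ?_ ?_ ?_ <;>
    simp <;> omega

theorem ent_succ {n : ℕ} (x : Fin n → ℝ) (i : Fin n) : ent x ((i : ℕ) + 1) = x i := by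
  have : 1 ≤ (i : ℕ) + 1 ∧ (i : ℕ) + 1 ≤ n := ⟨by omega, i.isLt⟩
  rw [ent, dif_pos this]
  simp

theorem ent_nonneg {n : ℕ} {x : Fin n → ℝ} (hx : ∀ j, 0 ≤ x j) (ℓ : ℕ) : 0 ≤ ent x ℓ := by
  rw [ent]
  split_ifs
  · exact hx _
  · exact le_rfl

theorem sVal_eq_sum_fin {n k : ℕ} (x : Fin n → ℝ) (hk : k ≤ n) :
    sVal x k = ∑ i : Fin n, if (i : ℕ) + 1 ≤ k then x i else 0 := by
  rw [sVal, ← sum_fin_ite_succ_le hk]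
  simp_rw [ent_succ]

theorem mVal_eq_sum_fin {n k : ℕ} (x : Fin n → ℝ) :
    mVal x k = ∑ i : Fin n, if (i : ℕ) + 1 ≤ k then 0 else x i ^ 2 := by
  rw [mVal, ← sum_fin_ite_le_succ (fun j => ent x j ^ 2)]
  simp_rw [ent_succ]

theorem mVal_nonneg {n : ℕ} (x : Fin n → ℝ) (k : ℕ) : 0 ≤ mVal x k :=
  Finset.sum_nonneg fun _ _ => sq_nonneg _

theorem sVal_succ {n : ℕ} (x : Fin n → ℝ) (k : ℕ) : sVal x (k + 1) = sVal x k + ent x (k + 1) :=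
  Finset.sum_Icc_succ_top (by omega) _

theorem mVal_eq_add {n k : ℕ} (x : Fin n → ℝ) (hk : k + 1 ≤ n) :
    mVal x k = ent x (k + 1) ^ 2 + mVal x (k + 1) := by
  rw [mVal, mVal, ← Finset.add_sum_Ioc_eq_sum_Icc (f := fun j => ent x j ^ 2) hk]
  congr 2
  ext j
  simp only [Finset.mem_Ioc, Finset.mem_Icc]
  omega

section quadratic

variable {n : ℕ} {x : Fin n → ℝ} {k : ℕ}

theorem two_mul_qVal (hk : 1 ≤ k) (hs : 0 < sVal x k) :
    2 * (k * sVal x k * qVal x k) =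
      pVal x k + √(pVal x k ^ 2 + 4 * k * mVal x k * sVal x k ^ 2) := by
  have hk' : (k : ℝ) ≠ 0 := by positivity
  rw [qVal]
  field_simp

theorem abs_pVal_le_sqrt :
    |pVal x k| ≤ √(pVal x k ^ 2 + 4 * k * mVal x k * sVal x k ^ 2) := by
  refine Real.abs_le_sqrt ?_
  have := mVal_nonneg x k
  have : 0 ≤ 4 * k * mVal x k * sVal x k ^ 2 := by positivity
  linarith

theorem qVal_nonneg (hs : 0 < sVal x k) : 0 ≤ qVal x k := by
  rw [qVal]
  have := (neg_le_abs _).trans (abs_pVal_le_sqrt (x := x) (k := k))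
  exact div_nonneg (by linarith) (by positivity)

theorem pVal_le_mul_qVal (hk : 1 ≤ k) (hs : 0 < sVal x k) :
    pVal x k ≤ k * sVal x k * qVal x k := by
  have h1 := two_mul_qVal hk hs
  have h2 := (le_abs_self _).trans (abs_pVal_le_sqrt (x := x) (k := k))
  linarith

/-- `q_ℓ` is a root of `(s_ℓ - ℓ t) (t s_ℓ + m_ℓ) = t`. -/
theorem qVal_root (hk : 1 ≤ k) (hs : 0 < sVal x k) :
    (sVal x k - k * qVal x k) * (qVal x k * sVal x k + mVal x k) = qVal x k := by
  have h1 := two_mul_qVal hk hs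
  have hm := mVal_nonneg x k
  have hsq := Real.sq_sqrt (show 0 ≤ pVal x k ^ 2 + 4 * k * mVal x k * sVal x k ^ 2 by positivity)
  set R := √(pVal x k ^ 2 + 4 * k * mVal x k * sVal x k ^ 2)
  have hR : R = 2 * (k * sVal x k * qVal x k) - pVal x k := by linarith
  rw [hR] at hsq
  have hne : (4 : ℝ) * k * sVal x k ≠ 0 := by positivity
  have hp : pVal x k = sVal x k ^ 2 - 1 - k * mVal x k := rfl
  apply mul_left_cancel₀ hne
  rw [hp] at hsq
  linear_combination -hsq

theorem quadratic_sub (hk : 1 ≤ k) (hs : 0 < sVal x k) (t : ℝ) :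
    t - (sVal x k - k * t) * (t * sVal x k + mVal x k) =
      (t - qVal x k) * (k * sVal x k * t + (k * sVal x k * qVal x k - pVal x k)) := by
  have hp : pVal x k = sVal x k ^ 2 - 1 - k * mVal x k := rfl
  rw [hp]
  linear_combination - qVal_root hk hs

theorem quadratic_nonpos (hk : 1 ≤ k) (hs : 0 < sVal x k) {t : ℝ} (ht : 0 ≤ t)
    (htq : t ≤ qVal x k) : t ≤ (sVal x k - k * t) * (t * sVal x k + mVal x k) := by
  have h1 := quadratic_sub hk hs t
  have h2 := pVal_le_mul_qVal hk hs
  have h3 : 0 ≤ k * sVal x k * t := by positivity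
  have := mul_nonneg (sub_nonneg.mpr htq) (add_nonneg h3 (sub_nonneg.mpr h2))
  linarith

theorem quadratic_pos (hk : 1 ≤ k) (hs : 0 < sVal x k) {t : ℝ}
    (htq : qVal x k < t) : (sVal x k - k * t) * (t * sVal x k + mVal x k) < t := by
  have h1 := quadratic_sub hk hs t
  have h2 := pVal_le_mul_qVal hk hs
  have ht : 0 < t := (qVal_nonneg hs).trans_lt htq
  have h3 : 0 < k * sVal x k * t := by positivity
  have := mul_pos (sub_pos.mpr htq) (add_pos_of_pos_of_nonneg h3 (sub_nonneg.mpr h2))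
  linarith

/-- If `x_{k+1} ≤ q_{k+1}`, then `x_{k+1} ≤ q_k`. -/
theorem ent_succ_le_qVal (hx : ∀ j, 0 ≤ x j) (hk : 1 ≤ k) (hkn : k + 1 ≤ n) (hs : 0 < sVal x k)
    (h : ent x (k + 1) ≤ qVal x (k + 1)) : ent x (k + 1) ≤ qVal x k := by
  by_contra! hlt
  have ha := ent_nonneg hx (k + 1)
  have hs' : 0 < sVal x (k + 1) := by rw [sVal_succ]; linarith
  have h1 := quadratic_pos hk hs hlt
  have h2 := quadratic_nonpos (by omega) hs' ha h
  rw [mVal_eq_add x hkn] at h1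
  rw [sVal_succ] at h2
  push_cast at h2
  linarith

end quadratic

/-- A weighted Cauchy–Schwarz inequality. -/
theorem sum_mul_sq_le_of_mul_eq {ι : Type*} [Fintype ι] {x d w : ι → ℝ} {μ : ℝ} (hμ : 0 < μ)
    (hd : ∀ i, 0 ≤ d i) (hw : ∀ i, μ * x i = w i * (μ + d i)) (hxw : ∑ i, x i * w i = μ)
    (r : ι → ℝ) : (∑ i, x i * r i) ^ 2 ≤ ∑ i, (μ + d i) * r i ^ 2 := by
  have h := Finset.sum_sq_le_sum_mul_sum_of_sq_le_mul Finset.univ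
    (r := fun i => (μ + d i) * w i * r i) (f := fun i => (μ + d i) * w i ^ 2)
    (g := fun i => (μ + d i) * r i ^ 2)
    (fun i _ => mul_nonneg (add_nonneg hμ.le (hd i)) (sq_nonneg _))
    (fun i _ => mul_nonneg (add_nonneg hμ.le (hd i)) (sq_nonneg _))
    (fun i _ => le_of_eq (by ring))
  have h1 : ∑ i, (μ + d i) * w i * r i = μ * ∑ i, x i * r i := by
    rw [Finset.mul_sum]
    exact Finset.sum_congr rfl fun i _ => by linear_combination - r i * hw i
  have h2 : ∑ i, (μ + d i) * w i ^ 2 = μ * μ := by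
    calc _ = ∑ i, μ * (x i * w i) :=
          Finset.sum_congr rfl fun i _ => by linear_combination - w i * hw i
      _ = μ * μ := by rw [← Finset.mul_sum, hxw]
  rw [h1, h2, mul_pow, ← sq] at h
  exact le_of_mul_le_mul_left h (by positivity)

/-- with `k` the maximal index with `x_k > q_k`, the state
`D = diag(d_1,…,d_k,0,…,0)`, `d_j = (x_j − q_k)/(s_k − k·q_k)`, attains the minimum of
`‖|x⟩⟨x| − δ‖_tr` and of `‖|x⟩⟨x| − δ‖` over incoherent states `δ`, with minimum values
`2(q_k s_k + m_k)` and `q_k s_k + m_k` respectively. -/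
theorem stmt8 {n : ℕ} (hn : 1 ≤ n) (x : Fin n → ℝ)
    (hunit : ∑ j, (x j) ^ 2 = 1)
    (hmono : ∀ i j : Fin n, i ≤ j → x j ≤ x i)
    (hnonneg : ∀ j, 0 ≤ x j)
    (k : ℕ) (hk : k ∈ Finset.Icc 1 n) (hkq : qVal x k < ent x k)
    (hkmax : ∀ ℓ ∈ Finset.Icc 1 n, qVal x ℓ < ent x ℓ → ℓ ≤ k) :
    IsIncoherent (DmatC x k) ∧
    (∀ δ, IsIncoherent δ →
      traceNorm (outerR x - DmatC x k) ≤ traceNorm (outerR x - δ)) ∧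
    (∀ δ, IsIncoherent δ →
      opNorm (outerR x - DmatC x k) ≤ opNorm (outerR x - δ)) ∧
    traceNorm (outerR x - DmatC x k) = 2 * (qVal x k * sVal x k + mVal x k) ∧
    opNorm (outerR x - DmatC x k) = qVal x k * sVal x k + mVal x k := by
  obtain ⟨hk1, hkn⟩ := Finset.mem_Icc.mp hk
  set q := qVal x k with hq
  set s := sVal x k with hs
  set m := mVal x k with hm
  have hsF := sVal_eq_sum_fin x hkn
  have hmF := mVal_eq_sum_fin (k := k) x
  rw [← hs] at hsF
  rw [← hm] at hmF
  have hent : ent x k = x ⟨k - 1, by omega⟩ := by rw [ent, dif_pos ⟨hk1, hkn⟩]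
  have hle : ∀ i : Fin n, (i : ℕ) + 1 ≤ k → ent x k ≤ x i := fun i hi => by
    rw [hent]
    exact hmono _ _ (Fin.mk_le_mk.mpr (by omega))
  have hconst : ∀ c : ℝ, ∑ i : Fin n, (if (i : ℕ) + 1 ≤ k then c else 0) = k * c := fun c => by
    rw [sum_fin_ite_succ_le hkn fun _ => c]
    simp
  have hkpos : (0 : ℝ) < k := by positivity
  have hks : k * ent x k ≤ s := by
    rw [hsF, ← hconst]
    refine Finset.sum_le_sum fun i _ => ?_
    split_ifs with hi
    · exact hle i hi
    · exact le_rfl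
  have hspos : 0 < s := by
    by_contra! hs0
    have hzero : ent x k = 0 := by
      have := ent_nonneg hnonneg k
      nlinarith
    have hs00 : sVal x k = 0 := by
      rw [hzero, mul_zero] at hks
      exact le_antisymm hs0 hks
    have : q = 0 := by rw [hq, qVal, hs00, mul_zero, div_zero]
    rw [this, hzero] at hkq
    exact lt_irrefl _ hkq
  have hq0 : 0 ≤ q := qVal_nonneg hspos
  have hm0 : 0 ≤ m := mVal_nonneg x k
  have hroot : (s - k * q) * (q * s + m) = q := qVal_root hk1 hspos
  have hc : 0 < s - k * q := by nlinarith
  set μ := q * s + m with hμ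
  have hμ0 : 0 ≤ μ := by positivity
  have htail : ∀ i : Fin n, ¬ (i : ℕ) + 1 ≤ k → x i ≤ q := by
    intro i hi
    have hkn' : k + 1 ≤ n := by omega
    have hnext : ent x (k + 1) ≤ qVal x (k + 1) := by
      by_contra! h
      have := hkmax (k + 1) (Finset.mem_Icc.mpr ⟨by omega, hkn'⟩) h
      omega
    refine le_trans ?_ (ent_succ_le_qVal hnonneg hk1 hkn' hspos hnext)
    have := ent_succ x ⟨k, hkn'⟩
    simp only at this
    rw [this]
    exact hmono _ _ (Fin.mk_le_mk.mpr (by omega))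
  set d : Fin n → ℝ := fun i => if (i : ℕ) + 1 ≤ k then (x i - q) / (s - k * q) else 0 with hd
  set w : Fin n → ℝ := fun i => if (i : ℕ) + 1 ≤ k then q else x i with hw
  have hD : DmatC x k = diagonal fun i => (d i : ℂ) := by
    rw [DmatC]
    congr 1
    ext i
    simp only [hd, ent_succ]
    split_ifs <;> simp [hq, hs]
  have hd0 : ∀ i, 0 ≤ d i := by
    intro i
    simp only [hd]
    split_ifs with hi
    · exact div_nonneg (by linarith [hle i hi]) hc.le
    · exact le_rfl
  have hd1 : ∑ i, d i = 1 := by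
    have : ∀ i : Fin n, d i = ((if (i : ℕ) + 1 ≤ k then x i else 0) -
        (if (i : ℕ) + 1 ≤ k then q else 0)) / (s - k * q) := fun i => by
      simp only [hd]
      split_ifs <;> simp
    simp_rw [this]
    rw [← Finset.sum_div, Finset.sum_sub_distrib, hconst, ← hsF, div_self hc.ne']
  have hw0 : ∀ i, 0 ≤ w i := by
    intro i
    simp only [hw]
    split_ifs
    exacts [hq0, hnonneg i]
  have hwq : ∀ i, w i ≤ q := by
    intro i
    simp only [hw]
    split_ifs with hi
    exacts [le_rfl, htail i hi]
  have hxw : ∑ i, x i * w i = μ := by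
    rw [hμ, hsF, hmF, Finset.mul_sum, ← Finset.sum_add_distrib]
    refine Finset.sum_congr rfl fun i _ => ?_
    simp only [hw]
    split_ifs <;> ring
  have hww : ∑ i, w i ^ 2 = k * q ^ 2 + m := by
    rw [hmF, ← hconst, ← Finset.sum_add_distrib]
    refine Finset.sum_congr rfl fun i _ => ?_
    simp only [hw]
    split_ifs <;> ring
  have hwd : ∀ i, μ * x i = w i * (μ + d i) := by
    intro i
    simp only [hw, hd]
    split_ifs with hi
    · have : q * ((x i - q) / (s - k * q)) = μ * (x i - q) := by
        rw [← mul_div_assoc, div_eq_iff hc.ne']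
        linear_combination -(x i - q) * hroot
      linear_combination -this
    · ring
  -- The quadratic form of `|x⟩⟨x| - D` is bounded by `μ`.
  have hupper : ∀ r : Fin n → ℝ, (∑ i, x i * r i) ^ 2 ≤ ∑ i, (μ + d i) * r i ^ 2 := by
    rcases hμ0.lt_or_eq with hμpos | hμz
    · exact sum_mul_sq_le_of_mul_eq hμpos hd0 hwd hxw
    · have hqz : q = 0 := by rw [← hroot, ← hμz, mul_zero]
      have hmz : m = 0 := by rw [hqz] at hμ; linarith
      have hxd : ∀ i, x i = s * d i := by
        intro i
        simp only [hd]
        split_ifs with hi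
        · rw [hqz]
          simp only [mul_zero, sub_zero]
          rw [mul_div_cancel₀ _ hspos.ne']
        · linarith [htail i hi, hnonneg i]
      have hs1 : s ^ 2 ≤ 1 := by
        have h1 := pVal_le_mul_qVal hk1 hspos
        rw [pVal, ← hs, ← hm, ← hq, hmz, hqz] at h1
        linarith
      have hsx : ∑ i, x i = s := by
        simp_rw [hxd]
        rw [← Finset.mul_sum, hd1, mul_one]
      intro r
      have h := Finset.sum_sq_le_sum_mul_sum_of_sq_le_mul Finset.univ
        (r := fun i => x i * r i) (f := x) (g := fun i => x i * r i ^ 2)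
        (fun i _ => hnonneg i) (fun i _ => mul_nonneg (hnonneg i) (sq_nonneg _))
        (fun i _ => le_of_eq (by ring))
      have h2 : ∑ i, x i * r i ^ 2 = s * ∑ i, d i * r i ^ 2 := by
        rw [Finset.mul_sum]
        exact Finset.sum_congr rfl fun i _ => by rw [← mul_assoc, ← hxd]
      rw [hsx, h2, ← mul_assoc, ← sq] at h
      refine h.trans ?_
      rw [← hμz]
      simp only [zero_add]
      exact mul_le_of_le_one_left
        (Finset.sum_nonneg fun i _ => mul_nonneg (hd0 i) (sq_nonneg _)) hs1
  -- `w` witnesses that no incoherent state does better.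
  have hlower : ∀ (e : Fin n → ℝ) (ν : ℝ), (∀ i, 0 ≤ e i) → ∑ i, e i = 1 → 0 ≤ ν →
      (∀ y : Fin n → ℂ, ‖∑ i, (x i : ℂ) * y i‖ ^ 2 - ∑ i, e i * ‖y i‖ ^ 2 ≤
        ν * ∑ i, ‖y i‖ ^ 2) → μ ≤ ν := by
    intro e ν he he1 hν h
    have h1 := h fun i => (w i : ℂ)
    have h2 : ∑ i, (x i : ℂ) * (w i : ℂ) = (μ : ℂ) := by
      rw [← hxw]
      push_cast
      rfl
    simp only [h2, Complex.norm_real, Real.norm_eq_abs, sq_abs, hww] at h1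
    have h3 : ∑ i, e i * w i ^ 2 ≤ q ^ 2 := by
      calc ∑ i, e i * w i ^ 2 ≤ ∑ i, e i * q ^ 2 := Finset.sum_le_sum fun i _ =>
            mul_le_mul_of_nonneg_left (pow_le_pow_left₀ (hw0 i) (hwq i) 2) (he i)
        _ = q ^ 2 := by rw [← Finset.sum_mul, he1, one_mul]
    have h4 : μ ^ 2 - q ^ 2 = μ * (k * q ^ 2 + m) := by
      linear_combination μ * hμ + q * hroot
    have h5 : μ * (k * q ^ 2 + m) ≤ ν * (k * q ^ 2 + m) := by linarith
    rcases (show 0 ≤ k * q ^ 2 + m by positivity).lt_or_eq with hpos | hz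
    · exact le_of_mul_le_mul_right h5 hpos
    · have hmz : m = 0 := by nlinarith [mul_nonneg hkpos.le (sq_nonneg q)]
      have hqz : q = 0 := by
        rw [hmz, add_zero] at hz
        simpa [hkpos.ne'] using hz.symm
      rw [hμ, hqz, hmz]
      linarith
  obtain ⟨μ', htrD, hopD, hμ'0, hallD, y, hy1, hyμ⟩ :=
    norms_outerR_sub_diagonal hn x d hunit hd0 hd1
  have hμ' : μ' = μ := by
    refine le_antisymm ?_ (hlower d μ' hd0 hd1 hμ'0 hallD)
    rw [← hyμ, sub_le_iff_le_add]
    have hnorm : ‖∑ i, (x i : ℂ) * y i‖ ≤ ∑ i, x i * ‖y i‖ := by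
      refine (norm_sum_le _ _).trans_eq (Finset.sum_congr rfl fun i _ => ?_)
      rw [norm_mul, Complex.norm_real, Real.norm_of_nonneg (hnonneg i)]
    calc _ ≤ (∑ i, x i * ‖y i‖) ^ 2 := pow_le_pow_left₀ (norm_nonneg _) hnorm 2
      _ ≤ ∑ i, (μ + d i) * ‖y i‖ ^ 2 := hupper fun i => ‖y i‖
      _ = μ + ∑ i, d i * ‖y i‖ ^ 2 := by
        simp_rw [add_mul]
        rw [Finset.sum_add_distrib, ← Finset.mul_sum, hy1, mul_one]
  rw [hμ'] at htrD hopD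
  rw [hD]
  refine ⟨isIncoherent_diagonal hd0 hd1, fun δ hδ => ?_, fun δ hδ => ?_, htrD, hopD⟩ <;>
  · obtain ⟨e, rfl, he, he1⟩ := hδ.exists_eq_diagonal
    obtain ⟨ν, htr, hop, hν, hall, -⟩ := norms_outerR_sub_diagonal hn x e hunit he he1
    have := hlower e ν he he1 hν hall
    linarith
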